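/- Let p ∈ [1,∞) and let u ∈ W^{2,p}(ℝⁿ). Then L_ε u → L u strongly in L^p(ℝⁿ) as ε → 0, where L_ε : W^{2,p}(ℝⁿ) → L^p(ℝⁿ) is the bounded extension of the nonlocal operator u ↦ P.V. ∫_{ℝⁿ} J_ε(x−y)(u(x) − u(y)) dy and L u := −div(M∇u). -/

import Mathlib

open MeasureTheory Filter Topology ENNReal

noncomputable section

abbrev EV (n : ℕ) := EuclideanSpace ℝ (Fin n)

/-- The kernel `J(x) = ρ(x)/|x|²`. -/
def kernelJ {n : ℕ} (ρ : EV n → ℝ) (x : EV n) : ℝ := ρ x / ‖x‖ ^ 2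

/-- The rescaled density `ρ_ε(x) = ε^{-n} ρ(x/ε)`. -/
def scaled {n : ℕ} (ρ : EV n → ℝ) (ε : ℝ) (x : EV n) : ℝ := (ε ^ n)⁻¹ * ρ (ε⁻¹ • x)

/-- Assumption (A1): `ρ` is measurable, nonnegative, not a.e. zero, even,
and `∫ ρ(x)(1+|x|) dx < ∞`. -/
def A1 {n : ℕ} (ρ : EV n → ℝ) : Prop :=
  Measurable ρ ∧ (∀ x, 0 ≤ ρ x) ∧ ¬ (ρ =ᵐ[volume] (fun _ => (0 : ℝ))) ∧
  (∀ᵐ x : EV n ∂volume, ρ (-x) = ρ x) ∧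
  Integrable (fun x : EV n => ρ x * (1 + ‖x‖)) volume

/-- `L_ε u (x) = ∫_{ℝⁿ} J_ε(x-y) (u(x) - u(y) - ∇u(x)·(x-y)) dy`. -/
def nlOp {n : ℕ} (ρ : EV n → ℝ) (ε : ℝ) (u : EV n → ℝ) (x : EV n) : ℝ :=
  ∫ y : EV n, kernelJ (scaled ρ ε) (x - y) * (u x - u y - fderiv ℝ u x (x - y))

/-- The classical partial derivative `∂ᵢ u`. -/
def partialD {n : ℕ} (i : Fin n) (u : EV n → ℝ) : EV n → ℝ :=
  fun x => fderiv ℝ u x (EuclideanSpace.single i 1)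

/-- Iterated classical partial derivatives along a list of directions. -/
def partialDList {n : ℕ} : List (Fin n) → (EV n → ℝ) → (EV n → ℝ)
  | [], u => u
  | i :: l, u => partialD i (partialDList l u)

/-- The momentum matrix `M = (1/2)∫_{ℝⁿ} J(z) z ⊗ z dz`. -/
def momentum {n : ℕ} (ρ : EV n → ℝ) : Matrix (Fin n) (Fin n) ℝ :=
  Matrix.of fun i j => (1 / 2 : ℝ) * ∫ z : EV n, kernelJ ρ z * z i * z j

/-- `v = ∂ᵢ u` weakly on `Ω`. -/
def WeakDerivOn {n : ℕ} (Ω : Set (EV n)) (i : Fin n) (u v : EV n → ℝ) : Prop :=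
  ∀ φ : EV n → ℝ, ContDiff ℝ (⊤ : ℕ∞) φ → HasCompactSupport φ → tsupport φ ⊆ Ω →
    ∫ x in Ω, u x * partialD i φ x = - ∫ x in Ω, v x * φ x

/-- `D` is a system of weak partial derivatives of `u` on `Ω` up to order `k`,
all lying in `L^p(Ω)`; i.e. `D` witnesses that `u ∈ W^{k,p}(Ω)`. -/
def IsSobDerivs {n : ℕ} (Ω : Set (EV n)) (k : ℕ) (p : ℝ≥0∞) (u : EV n → ℝ)
    (D : List (Fin n) → EV n → ℝ) : Prop :=
  D [] = u ∧
  (∀ l : List (Fin n), l.length < k → ∀ i : Fin n, WeakDerivOn Ω i (D l) (D (i :: l))) ∧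
  (∀ l : List (Fin n), l.length ≤ k → MemLp (D l) p (volume.restrict Ω))

/-- `u ∈ W^{k,p}(Ω)`. -/
def MemW {n : ℕ} (Ω : Set (EV n)) (k : ℕ) (p : ℝ≥0∞) (u : EV n → ℝ) : Prop :=
  ∃ D, IsSobDerivs Ω k p u D

/-- The `W^{k,p}`-norm computed from a system `D` of weak derivatives:
the sum of the `L^p` norms of all weak derivatives of order at most `k`. -/
def WNormD {n : ℕ} (k : ℕ) (p : ℝ≥0∞) (μ : Measure (EV n))
    (D : List (Fin n) → EV n → ℝ) : ℝ≥0∞ :=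
  ∑' l : List (Fin n), if l.length ≤ k then eLpNorm (D l) p μ else 0

/-- `L` is a bounded linear extension to `W^{2,p}(ℝⁿ)`, with operator bound `C`,
of the nonlocal operator `L_ε` (defined by the principal-value formula on `C_c²(ℝⁿ)`). -/
def IsNLExt {n : ℕ} (ρ : EV n → ℝ) (p : ℝ≥0∞) (ε C : ℝ)
    (L : (EV n → ℝ) → EV n → ℝ) : Prop :=
  (∀ u : EV n → ℝ, ContDiff ℝ 2 u → HasCompactSupport u → L u =ᵐ[volume] nlOp ρ ε u) ∧
  (∀ u v : EV n → ℝ, MemW Set.univ 2 p u → MemW Set.univ 2 p v → ∀ a b : ℝ,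
    L (fun x => a * u x + b * v x) =ᵐ[volume] fun x => a * L u x + b * L v x) ∧
  (∀ u : EV n → ℝ, MemW Set.univ 2 p u → MemLp (L u) p volume) ∧
  (∀ u D, IsSobDerivs Set.univ 2 p u D →
    eLpNorm (L u) p volume ≤ ENNReal.ofReal C * WNormD 2 p volume D)

lemma jensen_tonelli {X W : Type*} [MeasurableSpace X] [MeasurableSpace W] {μ : Measure X}
    [SFinite μ] {ν : Measure W} [IsFiniteMeasure ν] {p : ℝ≥0∞} (hp1 : 1 ≤ p) (hp : p ≠ ⊤)
    (f : X → ℝ) (g : X → W → ℝ) (hg : AEStronglyMeasurable (Function.uncurry g) (μ.prod ν))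
    (h : ∀ᵐ x ∂μ, ‖f x‖ₑ ≤ ∫⁻ w, ‖g x w‖ₑ ∂ν) :
    eLpNorm f p μ ^ p.toReal ≤ ν Set.univ ^ (p.toReal - 1) *
      ∫⁻ w, eLpNorm (fun x => g x w) p μ ^ p.toReal ∂ν := by
  have hp0 : p ≠ 0 := (zero_lt_one.trans_le hp1).ne'
  have hq : 1 ≤ p.toReal := by
    rw [← ENNReal.toReal_one]; exact ENNReal.toReal_mono hp hp1
  have hq0 : 0 < p.toReal := by linarith
  have e : ∀ {Y : Type _} [MeasurableSpace Y] (κ : Measure Y) (k : Y → ℝ),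
      eLpNorm k p κ ^ p.toReal = ∫⁻ x, ‖k x‖ₑ ^ p.toReal ∂κ := by
    intro Y _ κ k
    rw [eLpNorm_eq_lintegral_rpow_enorm_toReal hp0 hp, ← ENNReal.rpow_mul]
    rw [one_div, inv_mul_cancel₀ hq0.ne', ENNReal.rpow_one]
  have e' : ∀ (κ : Measure W) (k : W → ℝ),
      eLpNorm k p κ ^ p.toReal = ∫⁻ x, ‖k x‖ₑ ^ p.toReal ∂κ := by
    intro κ k
    rw [eLpNorm_eq_lintegral_rpow_enorm_toReal hp0 hp, ← ENNReal.rpow_mul]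
    rw [one_div, inv_mul_cancel₀ hq0.ne', ENNReal.rpow_one]
  rw [e]
  simp_rw [e]
  have hgx := hg.prodMk_left
  calc ∫⁻ x, ‖f x‖ₑ ^ p.toReal ∂μ
      ≤ ∫⁻ x, ν Set.univ ^ (p.toReal - 1) * ∫⁻ w, ‖g x w‖ₑ ^ p.toReal ∂ν ∂μ := by
        apply lintegral_mono_ae
        filter_upwards [h, hgx] with x hx hm
        have := eLpNorm_le_eLpNorm_mul_rpow_measure_univ hp1 hm
        rw [eLpNorm_one_eq_lintegral_enorm] at this
        calc ‖f x‖ₑ ^ p.toReal ≤ (∫⁻ w, ‖g x w‖ₑ ∂ν) ^ p.toReal := by gcongr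
          _ ≤ (eLpNorm (g x) p ν * ν Set.univ ^ (1 / (1:ℝ≥0∞).toReal - 1 / p.toReal)) ^ p.toReal := by
            gcongr; exact this
          _ = _ := by
            rw [ENNReal.mul_rpow_of_nonneg _ _ hq0.le, e', ← ENNReal.rpow_mul, mul_comm]
            congr 2
            simp only [ENNReal.toReal_one]
            field_simp
    _ = ν Set.univ ^ (p.toReal - 1) * ∫⁻ x, ∫⁻ w, ‖g x w‖ₑ ^ p.toReal ∂ν ∂μ := by
        rw [lintegral_const_mul']
        exact ENNReal.rpow_ne_top_of_nonneg (by linarith) (measure_ne_top _ _)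
    _ = _ := by
        congr 1
        rw [lintegral_lintegral_swap]
        exact (hg.enorm.pow_const _)

lemma transl_cont {n : ℕ} {p : ℝ≥0∞} (hp1 : 1 ≤ p) (hp : p ≠ ⊤)
    {f : EV n → ℝ} (hf : MemLp f p volume) :
    Continuous (fun h : EV n => eLpNorm (fun x => f (x - h) - f x) p volume) := by
  haveI : Fact (1 ≤ p) := ⟨hp1⟩
  haveI : Fact (p ≠ ⊤) := ⟨hp⟩
  have h1 : Continuous (fun h : EV n => ‖(DomAddAct.mk (-h) +ᵥ hf.toLp f) - hf.toLp f‖ₑ) := by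
    apply Continuous.enorm
    apply Continuous.sub _ continuous_const
    have : Continuous (fun h : EV n => DomAddAct.mk (-h)) := by
      exact DomAddAct.continuous_mk.comp continuous_neg
    exact this.vadd continuous_const
  convert h1 using 2 with h
  rw [DomAddAct.mk_vadd_toLp, ← MemLp.toLp_sub, Lp.enorm_toLp]
  congr 1
  ext x
  simp [sub_eq_add_neg, add_comm]

lemma eLpNorm_transl {n : ℕ} {p : ℝ≥0∞} {f : EV n → ℝ} (hf : AEStronglyMeasurable f volume) (h : EV n) :
    eLpNorm (fun x => f (x - h)) p volume = eLpNorm f p volume :=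
  eLpNorm_comp_measurePreserving hf (measurePreserving_sub_right volume h)

lemma aesm_transl {n : ℕ} {f : EV n → ℝ} (hf : AEStronglyMeasurable f volume) (h : EV n) :
    AEStronglyMeasurable (fun x => f (x - h)) volume :=
  hf.comp_measurePreserving (measurePreserving_sub_right volume h)

lemma smooth_partialD {n : ℕ} (i : Fin n) {v : EV n → ℝ} (hv : ContDiff ℝ (⊤ : ℕ∞) v) :
    ContDiff ℝ (⊤ : ℕ∞) (partialD i v) := by
  unfold partialD
  exact (hv.fderiv_right (m := ((⊤ : ℕ∞) : WithTop ℕ∞)) (by simp)).clm_apply contDiff_const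

lemma smooth_partialDList {n : ℕ} (l : List (Fin n)) {v : EV n → ℝ} (hv : ContDiff ℝ (⊤ : ℕ∞) v) :
    ContDiff ℝ (⊤ : ℕ∞) (partialDList l v) := by
  induction l with
  | nil => exact hv
  | cons i l ih => exact smooth_partialD i ih

lemma compact_partialD {n : ℕ} (i : Fin n) {v : EV n → ℝ} (hv : HasCompactSupport v) :
    HasCompactSupport (partialD i v) :=
  (hv.fderiv_apply ℝ _)

lemma compact_partialDList {n : ℕ} (l : List (Fin n)) {v : EV n → ℝ} (hv : HasCompactSupport v) :
    HasCompactSupport (partialDList l v) := by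
  induction l with
  | nil => exact hv
  | cons i l ih => exact compact_partialD i ih

lemma partialDList_congr {n : ℕ} (l : List (Fin n)) {v w : EV n → ℝ} {x : EV n}
    (h : v =ᶠ[𝓝 x] w) : partialDList l v =ᶠ[𝓝 x] partialDList l w := by
  induction l with
  | nil => exact h
  | cons i l ih =>
    have := ih.fderiv (𝕜 := ℝ)
    filter_upwards [this] with y hy
    simp only [partialDList, partialD, hy]

lemma smooth_diff {n : ℕ} {v : EV n → ℝ} (hv : ContDiff ℝ (⊤ : ℕ∞) v) : Differentiable ℝ v :=
  hv.differentiable (by simp)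

lemma partialD_mul {n : ℕ} (i : Fin n) {v w : EV n → ℝ} (hv : ContDiff ℝ (⊤ : ℕ∞) v)
    (hw : ContDiff ℝ (⊤ : ℕ∞) w) :
    partialD i (fun x => v x * w x) = fun x => v x * partialD i w x + partialD i v x * w x := by
  ext x
  unfold partialD
  rw [fderiv_fun_mul (smooth_diff hv x) (smooth_diff hw x)]
  simp [mul_comm]

lemma partialD_add {n : ℕ} (i : Fin n) {v w : EV n → ℝ} (hv : ContDiff ℝ (⊤ : ℕ∞) v)
    (hw : ContDiff ℝ (⊤ : ℕ∞) w) :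
    partialD i (fun x => v x + w x) = fun x => partialD i v x + partialD i w x := by
  ext x
  unfold partialD
  rw [fderiv_fun_add (smooth_diff hv x) (smooth_diff hw x)]
  simp

lemma integrable_mul_cc {n : ℕ} {f g : EV n → ℝ} (hf : LocallyIntegrable f volume)
    (hg : Continuous g) (hgc : HasCompactSupport g) : Integrable (fun x => f x * g x) volume := by
  have := hf.integrable_smul_left_of_hasCompactSupport hg hgc
  simpa [smul_eq_mul, mul_comm] using this

lemma memLp_loc {n : ℕ} {p : ℝ≥0∞} (hp1 : 1 ≤ p) {f : EV n → ℝ} (hf : MemLp f p volume) :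
    LocallyIntegrable f volume := hf.locallyIntegrable hp1

lemma weak_smooth {n : ℕ} (i : Fin n) {v : EV n → ℝ} (hv : ContDiff ℝ (⊤ : ℕ∞) v) :
    WeakDerivOn Set.univ i v (partialD i v) := by
  intro φ hφ hc _
  simp only [Measure.restrict_univ]
  have c1 := hv.continuous
  have c2 := (smooth_partialD i hv).continuous
  have c3 := (smooth_partialD i hφ).continuous
  unfold partialD at *
  apply integral_mul_fderiv_eq_neg_fderiv_mul_of_integrable
  · exact integrable_mul_cc c2.locallyIntegrable hφ.continuous hc
  · exact integrable_mul_cc c1.locallyIntegrable c3 (compact_partialD i hc)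
  · exact integrable_mul_cc c1.locallyIntegrable hφ.continuous hc
  · exact fun x _ => smooth_diff hv x
  · exact fun x _ => smooth_diff hφ x

lemma sob_smooth {n : ℕ} {p : ℝ≥0∞} {k : ℕ} {φ : EV n → ℝ} (hφ : ContDiff ℝ (⊤ : ℕ∞) φ)
    (hc : HasCompactSupport φ) :
    IsSobDerivs Set.univ k p φ (fun l => partialDList l φ) := by
  refine ⟨rfl, fun l _ i => weak_smooth i (smooth_partialDList l hφ), fun l _ => ?_⟩
  exact (smooth_partialDList l hφ).continuous.memLp_of_hasCompactSupport (compact_partialDList l hc)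

lemma sob_sub {n : ℕ} {p : ℝ≥0∞} (hp1 : 1 ≤ p) {k : ℕ} {u v : EV n → ℝ} {D E : List (Fin n) → EV n → ℝ}
    (hu : IsSobDerivs Set.univ k p u D) (hv : IsSobDerivs Set.univ k p v E) :
    IsSobDerivs Set.univ k p (fun x => 1 * u x + (-1) * v x) (fun l x => D l x - E l x) := by
  obtain ⟨h1, h2, h3⟩ := hu
  obtain ⟨g1, g2, g3⟩ := hv
  refine ⟨?_, ?_, ?_⟩
  · ext x; simp [h1, g1, sub_eq_add_neg]
  · intro l hl i φ hφ hc hs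
    have a1 := h2 l hl i φ hφ hc hs
    have a2 := g2 l hl i φ hφ hc hs
    have m1 := h3 l hl.le
    have m2 := g3 l hl.le
    have m3 := h3 (i :: l) (by simp; omega)
    have m4 := g3 (i :: l) (by simp; omega)
    simp only [Measure.restrict_univ] at *
    have c3 := (smooth_partialD i hφ).continuous
    have c4 := compact_partialD i hc
    simp only [sub_mul]
    rw [integral_sub, integral_sub, a1, a2]
    · ring
    · exact integrable_mul_cc (memLp_loc hp1 m3) hφ.continuous hc
    · exact integrable_mul_cc (memLp_loc hp1 m4) hφ.continuous hc
    · exact integrable_mul_cc (memLp_loc hp1 m1) c3 c4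
    · exact integrable_mul_cc (memLp_loc hp1 m2) c3 c4
  · intro l hl
    exact (h3 l hl).sub (g3 l hl)

def shortLists (n : ℕ) : Finset (List (Fin n)) := (List.finite_length_le (Fin n) 2).toFinset

lemma mem_shortLists {n : ℕ} (l : List (Fin n)) : l ∈ shortLists n ↔ l.length ≤ 2 := by
  simp [shortLists]

lemma WNormD_le {n : ℕ} {p : ℝ≥0∞} {D : List (Fin n) → EV n → ℝ} {a : ℝ≥0∞}
    (h : ∀ l : List (Fin n), l.length ≤ 2 → eLpNorm (D l) p volume ≤ a) :
    WNormD 2 p volume D ≤ (shortLists n).card * a := by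
  unfold WNormD
  rw [tsum_eq_sum (s := shortLists n)]
  · rw [← nsmul_eq_mul]
    apply Finset.sum_le_card_nsmul
    intro l hl
    rw [mem_shortLists] at hl
    simp [hl, h l hl]
  · intro l hl
    rw [mem_shortLists] at hl
    simp [hl]

/-- mollification -/
def mol {n : ℕ} (η f : EV n → ℝ) (x : EV n) : ℝ := ∫ y, f y * η (x - y)

lemma mol_eq_conv {n : ℕ} (η f : EV n → ℝ) :
    mol η f = convolution f η (ContinuousLinearMap.mul ℝ ℝ) volume := by
  ext x; simp [mol, convolution]

lemma mol_smooth {n : ℕ} {η f : EV n → ℝ} (hη : ContDiff ℝ (⊤ : ℕ∞) η) (hc : HasCompactSupport η)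
    (hf : LocallyIntegrable f volume) : ContDiff ℝ (⊤ : ℕ∞) (mol η f) := by
  rw [mol_eq_conv]
  exact hc.contDiff_convolution_right _ hf hη

lemma mol_partialD {n : ℕ} {η f g : EV n → ℝ} {i : Fin n} (hη : ContDiff ℝ (⊤ : ℕ∞) η)
    (hc : HasCompactSupport η) (hf : LocallyIntegrable f volume)
    (hw : WeakDerivOn Set.univ i f g) : partialD i (mol η f) = mol η g := by
  ext x
  have h1 := hc.hasFDerivAt_convolution_right (ContinuousLinearMap.mul ℝ ℝ) hf
    (hη.of_le (by exact_mod_cast le_top)) x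
  rw [← mol_eq_conv] at h1
  unfold partialD
  rw [h1.fderiv, convolution_precompR_apply _ hf (hc.fderiv ℝ) (hη.continuous_fderiv (by simp))]
  have hη' : ContDiff ℝ (⊤ : ℕ∞) (fun y => η (x - y)) := hη.comp (contDiff_const.sub contDiff_id)
  have hc' : HasCompactSupport (fun y => η (x - y)) :=
    hc.comp_homeomorph (Homeomorph.subLeft x)
  have := hw _ hη' hc' (Set.subset_univ _)
  simp only [Measure.restrict_univ] at this
  unfold mol
  rw [← neg_neg (∫ y, g y * η (x - y)), ← this, ← integral_neg]
  simp only [convolution, ContinuousLinearMap.mul_apply']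
  congr 1
  ext y
  have : HasFDerivAt (fun y => η (x - y)) ((fderiv ℝ η (x - y)).comp (-ContinuousLinearMap.id ℝ (EV n))) y := by
    apply (smooth_diff hη (x - y)).hasFDerivAt.comp
    exact (hasFDerivAt_id y).const_sub x
  unfold partialD
  rw [this.fderiv]
  simp

lemma mol_partialDList {n : ℕ} {p : ℝ≥0∞} (hp1 : 1 ≤ p) {η u : EV n → ℝ} {k : ℕ}
    {D : List (Fin n) → EV n → ℝ} (hD : IsSobDerivs Set.univ k p u D)
    (hη : ContDiff ℝ (⊤ : ℕ∞) η) (hc : HasCompactSupport η) (l : List (Fin n)) (hl : l.length ≤ k) :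
    partialDList l (mol η u) = mol η (D l) := by
  obtain ⟨h1, h2, h3⟩ := hD
  induction l with
  | nil => rw [h1]; rfl
  | cons i l ih =>
    simp only [List.length_cons] at hl
    simp only [partialDList]
    rw [ih (by omega)]
    have := h3 l (by omega)
    rw [Measure.restrict_univ] at this
    exact mol_partialD hη hc (memLp_loc hp1 this) (h2 l (by omega) i)

lemma mol_close {n : ℕ} {p : ℝ≥0∞} (hp1 : 1 ≤ p) (hp : p ≠ ⊤) {f η : EV n → ℝ}
    (hf : MemLp f p volume) (hη : Continuous η) (hc : HasCompactSupport η) (h0 : ∀ x, 0 ≤ η x)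
    (h_intg : ∫ x, η x = 1) {a : ℝ≥0∞}
    (ha : ∀ z, η z ≠ 0 → eLpNorm (fun x => f (x - z) - f x) p volume ≤ a) :
    eLpNorm (fun x => mol η f x - f x) p volume ≤ a := by
  have hq : 1 ≤ p.toReal := by
    rw [← ENNReal.toReal_one]; exact ENNReal.toReal_mono hp hp1
  have hq0 : 0 < p.toReal := by linarith
  set ν : Measure (EV n) := volume.withDensity (fun z => ENNReal.ofReal (η z)) with hν
  have hηi : Integrable η volume := hη.integrable_of_hasCompactSupport hc
  have hm : Measurable (fun z => ENNReal.ofReal (η z)) := hη.measurable.ennreal_ofReal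
  have hν1 : ν Set.univ = 1 := by
    rw [hν, withDensity_apply _ MeasurableSet.univ, Measure.restrict_univ,
      ← ofReal_integral_eq_lintegral_ofReal hηi (ae_of_all _ h0), h_intg]
    simp
  have : IsFiniteMeasure ν := ⟨by rw [hν1]; simp⟩
  have key := jensen_tonelli (μ := volume) (ν := ν) hp1 hp (fun x => mol η f x - f x)
    (fun x z => f (x - z) - f x) ?_ ?_
  · rw [hν1, ENNReal.one_rpow, one_mul] at key
    rw [← ENNReal.rpow_le_rpow_iff hq0]
    refine key.trans ?_
    calc _ ≤ ∫⁻ z, a ^ p.toReal ∂ν := by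
          rw [hν, lintegral_withDensity_eq_lintegral_mul_non_measurable _ hm (by simp),
            lintegral_withDensity_eq_lintegral_mul_non_measurable _ hm (by simp)]
          apply lintegral_mono
          intro z
          simp only [Pi.mul_apply]
          by_cases hz : η z = 0
          · simp [hz]
          · gcongr
            exact ha z hz
      _ = _ := by simp [hν1]
  · have hac : (volume : Measure (EV n)).prod ν ≪ (volume : Measure (EV n)).prod volume :=
      Measure.AbsolutelyContinuous.prod .rfl (withDensity_absolutelyContinuous _ _)
    have : AEStronglyMeasurable (Function.uncurry fun x z => f (x - z) - f x)
        ((volume : Measure (EV n)).prod volume) := by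
      apply AEStronglyMeasurable.sub
      · exact hf.1.comp_quasiMeasurePreserving (quasiMeasurePreserving_sub _ _)
      · exact hf.1.comp_fst
    exact this.mono_ac hac
  · refine ae_of_all _ fun x => ?_
    have e1 : mol η f x = ∫ z, f (x - z) * η z := by
      unfold mol
      rw [← integral_sub_left_eq_self _ volume x]
      simp
    have hi1 : Integrable (fun z => f (x - z) * η z) volume := by
      have hc' : HasCompactSupport (fun y => η (x - y)) := hc.comp_homeomorph (Homeomorph.subLeft x)
      have := (integrable_mul_cc (memLp_loc hp1 hf) (hη.comp (continuous_const.sub continuous_id)) hc').comp_sub_left x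
      simpa using this
    have e2 : mol η f x - f x = ∫ z, (f (x - z) - f x) * η z := by
      simp only [sub_mul]
      rw [integral_sub hi1 (hηi.const_mul _), e1, integral_const_mul, h_intg, mul_one]
    rw [e2]
    refine (enorm_integral_le_lintegral_enorm _).trans ?_
    rw [hν, lintegral_withDensity_eq_lintegral_mul_non_measurable _ hm (by simp)]
    apply lintegral_mono
    intro z
    simp only [Pi.mul_apply, enorm_mul]
    rw [mul_comm, Real.enorm_of_nonneg (h0 z)]

/-- smooth approximations (no compact support) -/
lemma exists_smooth_approx {n : ℕ} {p : ℝ≥0∞} (hp1 : 1 ≤ p) (hp : p ≠ ⊤) {u : EV n → ℝ}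
    {D : List (Fin n) → EV n → ℝ} (hD : IsSobDerivs Set.univ 2 p u D) {a : ℝ≥0∞} (ha : 0 < a) :
    ∃ v : EV n → ℝ, ContDiff ℝ (⊤ : ℕ∞) v ∧ ∀ l : List (Fin n), l.length ≤ 2 →
      eLpNorm (fun x => partialDList l v x - D l x) p volume ≤ a := by
  have hm : ∀ l : List (Fin n), l.length ≤ 2 → MemLp (D l) p volume := by
    simpa using hD.2.2
  have h1 : ∀ l ∈ shortLists n, ∀ᶠ z in 𝓝 (0 : EV n),
      eLpNorm (fun x => D l (x - z) - D l x) p volume ≤ a := by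
    intro l hl
    have := (transl_cont hp1 hp (hm l ((mem_shortLists l).1 hl))).tendsto 0
    simp only [sub_zero, sub_self, eLpNorm_zero'] at this
    exact (this.eventually_lt_const ha).mono fun z hz => hz.le
  rw [← Finset.eventually_all (shortLists n)] at h1
  obtain ⟨δ, hδ, hb⟩ := Metric.eventually_nhds_iff_ball.1 h1
  let b : ContDiffBump (0 : EV n) := ⟨δ / 2, δ, by positivity, by linarith⟩
  have s1 : ContDiff ℝ (⊤ : ℕ∞) (b.normed volume) := b.contDiff_normed
  have s2 : HasCompactSupport (b.normed volume) := b.hasCompactSupport_normed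
  refine ⟨mol (b.normed volume) u, mol_smooth s1 s2 ?_, ?_⟩
  · rw [← hD.1]; exact memLp_loc hp1 (hm [] (by simp))
  intro l hl
  rw [mol_partialDList hp1 hD s1 s2 l hl]
  apply mol_close hp1 hp (hm l hl) s1.continuous s2 b.nonneg_normed b.integral_normed
  intro z hz
  have : z ∈ Function.support (b.normed volume) := hz
  rw [b.support_normed_eq] at this
  exact hb z this l ((mem_shortLists l).2 hl)

lemma eLpNorm_dct {X : Type*} [MeasurableSpace X] {μ : Measure X} {p : ℝ≥0∞} (hp1 : 1 ≤ p)
    (hp : p ≠ ⊤) {F : ℕ → X → ℝ} {G : X → ℝ} (hF : ∀ k, AEStronglyMeasurable (F k) μ)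
    (hG : MemLp G p μ) (hb : ∀ k x, ‖F k x‖ ≤ ‖G x‖)
    (hlim : ∀ x, Tendsto (fun k => F k x) atTop (𝓝 0)) :
    Tendsto (fun k => eLpNorm (F k) p μ) atTop (𝓝 0) := by
  have hp0 : p ≠ 0 := (zero_lt_one.trans_le hp1).ne'
  have hq0 : 0 < p.toReal := ENNReal.toReal_pos hp0 hp
  have h := tendsto_lintegral_of_dominated_convergence' (μ := μ)
    (F := fun k x => ‖F k x‖ₑ ^ p.toReal) (f := fun _ => 0) (fun x => ‖G x‖ₑ ^ p.toReal)
    (fun k => (hF k).enorm.pow_const _) (fun k => ae_of_all _ fun x => ?_) ?_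
    (ae_of_all _ fun x => ?_)
  · simp only [lintegral_zero] at h
    have h2 := (ENNReal.continuous_rpow_const (y := 1 / p.toReal)).tendsto 0 |>.comp h
    rw [ENNReal.zero_rpow_of_pos (by positivity)] at h2
    refine h2.congr fun k => ?_
    rw [eLpNorm_eq_lintegral_rpow_enorm_toReal hp0 hp]
    rfl
  · have : ‖F k x‖ₑ ≤ ‖G x‖ₑ := enorm_le_iff_norm_le.2 (hb k x)
    exact ENNReal.rpow_le_rpow this hq0.le
  · exact ((eLpNorm_lt_top_iff_lintegral_rpow_enorm_lt_top hp0 hp).1 hG.2).ne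
  · have := (ENNReal.continuous_rpow_const (y := p.toReal)).tendsto _ |>.comp (hlim x).enorm
    simpa [Function.comp_def, ENNReal.zero_rpow_of_pos hq0] using this

lemma partialDList_scale {n : ℕ} (r : ℝ) (l : List (Fin n)) {w : EV n → ℝ}
    (hw : ContDiff ℝ (⊤ : ℕ∞) w) :
    partialDList l (fun x => w (r • x)) = fun x => r ^ l.length * partialDList l w (r • x) := by
  induction l with
  | nil => simp [partialDList]
  | cons i l ih =>
    simp only [partialDList]
    rw [ih]
    ext x
    have hs := smooth_partialDList l hw
    have h1 : HasFDerivAt (fun x : EV n => r ^ l.length * partialDList l w (r • x))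
        (r ^ l.length • ((fderiv ℝ (partialDList l w) (r • x)).comp
          (r • ContinuousLinearMap.id ℝ (EV n)))) x := by
      apply HasFDerivAt.const_mul
      apply (smooth_diff hs (r • x)).hasFDerivAt.comp
      exact (hasFDerivAt_id x).const_smul r
    unfold partialD
    rw [h1.fderiv]
    simp [pow_succ]
    ring

lemma bound_partialDList {n : ℕ} {w : EV n → ℝ} (hw : ContDiff ℝ (⊤ : ℕ∞) w)
    (hc : HasCompactSupport w) :
    ∃ C : ℝ, 0 ≤ C ∧ ∀ l : List (Fin n), l.length ≤ 2 → ∀ x, |partialDList l w x| ≤ C := by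
  have h : ∀ l : List (Fin n), ∃ C : ℝ, 0 ≤ C ∧ ∀ x, |partialDList l w x| ≤ C := by
    intro l
    obtain ⟨C, hC⟩ := (compact_partialDList l hc).exists_bound_of_continuous
      (smooth_partialDList l hw).continuous
    exact ⟨C, (norm_nonneg _).trans (hC 0), hC⟩
  choose C hC0 hC using h
  refine ⟨∑ l ∈ shortLists n, C l, Finset.sum_nonneg fun l _ => hC0 l, fun l hl x => ?_⟩
  exact (hC l x).trans
    (Finset.single_le_sum (f := C) (fun l _ => hC0 l) ((mem_shortLists l).2 hl))

lemma leibniz_bound {n : ℕ} {c v : EV n → ℝ} (hc : ContDiff ℝ (⊤ : ℕ∞) c)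
    (hv : ContDiff ℝ (⊤ : ℕ∞) v) {C : ℝ} (hC0 : 0 ≤ C)
    (hC : ∀ l : List (Fin n), l.length ≤ 2 → ∀ x, |partialDList l c x| ≤ C)
    (l : List (Fin n)) (hl : l.length ≤ 2) (x : EV n) :
    |partialDList l (fun x => c x * v x) x| ≤ 4 * C * ∑ l ∈ shortLists n, |partialDList l v x| := by
  set S := ∑ l ∈ shortLists n, |partialDList l v x| with hS
  have hSl : ∀ l : List (Fin n), l.length ≤ 2 → |partialDList l v x| ≤ S := fun l hl =>
    Finset.single_le_sum (f := fun l => |partialDList l v x|) (fun l _ => abs_nonneg _)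
      ((mem_shortLists l).2 hl)
  have hS0 : 0 ≤ S := Finset.sum_nonneg fun l _ => abs_nonneg _
  have hm : ∀ l l' : List (Fin n), l.length ≤ 2 → l'.length ≤ 2 →
      |partialDList l c x * partialDList l' v x| ≤ C * S := by
    intro l l' h h'
    rw [abs_mul]
    exact mul_le_mul (hC l h x) (hSl l' h') (abs_nonneg _) hC0
  have hCS : 0 ≤ C * S := by positivity
  match l, hl with
  | [], _ =>
    have := hm [] [] (by simp) (by simp)
    simp only [partialDList] at this ⊢
    linarith
  | [i], _ =>
    have h1 := hm [] [i] (by simp) (by simp)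
    have h2 := hm [i] [] (by simp) (by simp)
    simp only [partialDList] at h1 h2 ⊢
    rw [partialD_mul i hc hv]
    refine (abs_add_le _ _).trans ?_
    linarith
  | [i, j], _ =>
    have h1 := hm [] [i, j] (by simp) (by simp)
    have h2 := hm [i] [j] (by simp) (by simp)
    have h3 := hm [j] [i] (by simp) (by simp)
    have h4 := hm [i, j] [] (by simp) (by simp)
    simp only [partialDList] at h1 h2 h3 h4 ⊢
    have sc := smooth_partialD j hc
    have sv := smooth_partialD j hv
    rw [partialD_mul j hc hv, partialD_add i (hc.mul sv) (sc.mul hv), partialD_mul i hc sv,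
      partialD_mul i sc hv]
    refine (abs_add_le _ _).trans ?_
    refine (add_le_add (abs_add_le _ _) (abs_add_le _ _)).trans ?_
    linarith

lemma exists_cutoff {n : ℕ} {p : ℝ≥0∞} (hp1 : 1 ≤ p) (hp : p ≠ ⊤) {v : EV n → ℝ}
    (hv : ContDiff ℝ (⊤ : ℕ∞) v)
    (hm : ∀ l : List (Fin n), l.length ≤ 2 → MemLp (partialDList l v) p volume)
    {a : ℝ≥0∞} (ha : 0 < a) :
    ∃ φ : EV n → ℝ, ContDiff ℝ (⊤ : ℕ∞) φ ∧ HasCompactSupport φ ∧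
      ∀ l : List (Fin n), l.length ≤ 2 →
      eLpNorm (fun x => partialDList l φ x - partialDList l v x) p volume ≤ a := by
  let b : ContDiffBump (0 : EV n) := ⟨1, 2, by norm_num, by norm_num⟩
  have hb : ContDiff ℝ (⊤ : ℕ∞) b := b.contDiff
  have hbc : HasCompactSupport b := b.hasCompactSupport
  obtain ⟨C, hC0, hC⟩ := bound_partialDList hb hbc
  let r : ℕ → ℝ := fun k => ((k : ℝ) + 1)⁻¹
  have hr0 : ∀ k, 0 < r k := fun k => by positivity
  have hr1 : ∀ k, r k ≤ 1 := fun k => inv_le_one_of_one_le₀ (by linarith [Nat.cast_nonneg (α := ℝ) k])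
  have hrt : Tendsto r atTop (𝓝 0) := by
    have := tendsto_one_div_add_atTop_nhds_zero_nat (𝕜 := ℝ)
    simpa [r] using this
  let c : ℕ → EV n → ℝ := fun k x => b (r k • x)
  have hcs : ∀ k, ContDiff ℝ (⊤ : ℕ∞) (c k) := fun k => hb.comp (contDiff_const_smul _)
  have hcc : ∀ k, HasCompactSupport (c k) := fun k =>
    hbc.comp_homeomorph (Homeomorph.smulOfNeZero (r k) (hr0 k).ne')
  have hcC : ∀ k, ∀ l : List (Fin n), l.length ≤ 2 → ∀ x, |partialDList l (c k) x| ≤ C := by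
    intro k l hl x
    simp only [c]
    rw [partialDList_scale (r k) l hb]
    simp only [abs_mul]
    have h1 : |r k ^ l.length| ≤ 1 := by
      rw [abs_of_nonneg (by have := hr0 k; positivity)]
      exact pow_le_one₀ (hr0 k).le (hr1 k)
    calc _ ≤ 1 * C := mul_le_mul h1 (hC l hl _) (abs_nonneg _) zero_le_one
      _ = C := one_mul C
  let G : EV n → ℝ := fun x => (4 * C + 1) * ∑ l ∈ shortLists n, |partialDList l v x|
  have hG : MemLp G p volume := by
    apply MemLp.const_mul
    apply memLp_finsetSum
    intro l hl
    exact (hm l ((mem_shortLists l).1 hl)).abs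
  have ht : ∀ l ∈ shortLists n, ∀ᶠ k in atTop,
      eLpNorm (fun x => partialDList l (fun x => c k x * v x) x - partialDList l v x) p volume ≤ a := by
    intro l hl
    have hl' := (mem_shortLists l).1 hl
    have := eLpNorm_dct (μ := volume) hp1 hp
      (F := fun k x => partialDList l (fun x => c k x * v x) x - partialDList l v x) (G := G)
      (fun k => ?_) hG (fun k x => ?_) (fun x => ?_)
    · exact (this.eventually_lt_const ha).mono fun k hk => hk.le
    · exact ((smooth_partialDList l ((hcs k).mul hv)).continuous.sub
        (smooth_partialDList l hv).continuous).aestronglyMeasurable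
    · have h1 := leibniz_bound (hcs k) hv hC0 (hcC k) l hl' x
      have h2 : |partialDList l v x| ≤ ∑ l ∈ shortLists n, |partialDList l v x| :=
        Finset.single_le_sum (f := fun l => |partialDList l v x|) (fun l _ => abs_nonneg _) hl
      rw [Real.norm_eq_abs, Real.norm_eq_abs]
      refine (abs_sub _ _).trans ?_
      refine le_trans ?_ (le_abs_self _)
      simp only [G]
      linarith
    · apply tendsto_const_nhds.congr'
      have h1 : Tendsto (fun k => ‖r k • x‖) atTop (𝓝 0) := by
        have := (hrt.smul_const x).norm
        simpa using this
      filter_upwards [h1.eventually_lt_const zero_lt_one] with k hk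
      have h2 : (fun x => c k x * v x) =ᶠ[𝓝 x] v := by
        have : ∀ᶠ y in 𝓝 x, ‖r k • y‖ < 1 :=
          (continuous_const_smul (r k)).norm.continuousAt.eventually_lt_const hk
        filter_upwards [this] with y hy
        have : b (r k • y) = 1 := b.one_of_mem_closedBall (by simpa using hy.le)
        simp [c, this]
      rw [(partialDList_congr l h2).self_of_nhds, sub_self]
  rw [← Finset.eventually_all (shortLists n)] at ht
  obtain ⟨k, hk⟩ := ht.exists
  exact ⟨fun x => c k x * v x, (hcs k).mul hv, (hcc k).mul_right,
    fun l hl => hk l ((mem_shortLists l).2 hl)⟩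

lemma exists_approx {n : ℕ} {p : ℝ≥0∞} (hp1 : 1 ≤ p) (hp : p ≠ ⊤) {u : EV n → ℝ}
    {D : List (Fin n) → EV n → ℝ} (hD : IsSobDerivs Set.univ 2 p u D) {a : ℝ≥0∞} (ha : 0 < a) :
    ∃ φ : EV n → ℝ, ContDiff ℝ (⊤ : ℕ∞) φ ∧ HasCompactSupport φ ∧
      ∀ l : List (Fin n), l.length ≤ 2 →
      eLpNorm (fun x => D l x - partialDList l φ x) p volume ≤ a := by
  have hmD : ∀ l : List (Fin n), l.length ≤ 2 → MemLp (D l) p volume := by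
    simpa using hD.2.2
  have ha2 : 0 < min (a / 2) 1 := lt_min (ENNReal.half_pos ha.ne') one_pos
  obtain ⟨v, hv, hvD⟩ := exists_smooth_approx hp1 hp hD ha2
  have hs : ∀ l : List (Fin n), AEStronglyMeasurable (partialDList l v) volume := fun l =>
    (smooth_partialDList l hv).continuous.aestronglyMeasurable
  have hm : ∀ l : List (Fin n), l.length ≤ 2 → MemLp (partialDList l v) p volume := by
    intro l hl
    have h1 : MemLp (fun x => partialDList l v x - D l x) p volume :=
      ⟨(hs l).sub (hmD l hl).1,
        ((hvD l hl).trans (min_le_right _ _)).trans_lt ENNReal.one_lt_top⟩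
    have := h1.add (hmD l hl)
    refine this.ae_eq (ae_of_all _ fun x => ?_)
    simp
  obtain ⟨φ, h1, h2, h3⟩ := exists_cutoff hp1 hp hv hm ha2
  refine ⟨φ, h1, h2, fun l hl => ?_⟩
  rw [← eLpNorm_neg]
  have hs' : AEStronglyMeasurable (partialDList l φ) volume :=
    (smooth_partialDList l h1).continuous.aestronglyMeasurable
  calc _ = eLpNorm ((fun x => partialDList l φ x - partialDList l v x) +
        (fun x => partialDList l v x - D l x)) p volume := by
        congr 1; ext x; simp
    _ ≤ _ := eLpNorm_add_le (hs'.sub (hs l)) ((hs l).sub (hmD l hl).1) hp1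
    _ ≤ a / 2 + a / 2 := add_le_add ((h3 l hl).trans (min_le_left _ _))
        ((hvD l hl).trans (min_le_left _ _))
    _ = a := ENNReal.add_halves a

lemma taylor1 {q q' q'' : ℝ → ℝ} (h1 : ∀ t, HasDerivAt q (q' t) t)
    (h2 : ∀ t, HasDerivAt q' (q'' t) t) (hc : Continuous q'') (h0 : q 0 = 0) (h0' : q' 0 = 0) :
    |q 1| ≤ ∫ t in (0:ℝ)..1, |q'' t| := by
  have h3 : ∀ t ∈ Set.uIcc (0:ℝ) 1,
      HasDerivAt (fun t => q t + (1 - t) * q' t) ((1 - t) * q'' t) t := by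
    intro t _
    have := (h1 t).add (((hasDerivAt_id t).const_sub 1).mul (h2 t))
    refine this.congr_deriv ?_
    simp
  have hc' : Continuous (fun t => (1 - t) * q'' t) := by fun_prop
  have h4 := intervalIntegral.integral_eq_sub_of_hasDerivAt h3 (hc'.intervalIntegrable _ _)
  simp only [h0, h0', sub_self, zero_mul, mul_zero, add_zero, sub_zero] at h4
  rw [← h4]
  refine (intervalIntegral.abs_integral_le_integral_abs zero_le_one).trans ?_
  apply intervalIntegral.integral_mono_on zero_le_one (hc'.abs.intervalIntegrable _ _)
    (hc.abs.intervalIntegrable _ _)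
  intro t ht
  rw [abs_mul]
  have : |1 - t| ≤ 1 := by rw [abs_le]; constructor <;> linarith [ht.1, ht.2]
  exact mul_le_of_le_one_left (abs_nonneg _) this

lemma fderiv_expand {n : ℕ} (φ : EV n → ℝ) (y h : EV n) :
    fderiv ℝ φ y h = ∑ j, h j * partialD j φ y := by
  have : h = ∑ j, h j • EuclideanSpace.single j (1:ℝ) := by
    have := (EuclideanSpace.basisFun (Fin n) ℝ).sum_repr h
    simpa using this.symm
  conv_lhs => rw [this]
  simp [partialD]

/-- modulus of second derivatives -/
def modG {n : ℕ} (φ : EV n → ℝ) (x k : EV n) : ℝ :=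
  ∑ i, ∑ j, |partialDList [i, j] φ (x - k) - partialDList [i, j] φ x|

lemma modG_nonneg {n : ℕ} (φ : EV n → ℝ) (x k : EV n) : 0 ≤ modG φ x k :=
  Finset.sum_nonneg fun _ _ => Finset.sum_nonneg fun _ _ => abs_nonneg _

lemma modG_cont {n : ℕ} {φ : EV n → ℝ} (hφ : ContDiff ℝ (⊤ : ℕ∞) φ) :
    Continuous (fun z : EV n × EV n => modG φ z.1 z.2) := by
  unfold modG
  refine continuous_finsetSum _ fun i _ => continuous_finsetSum _ fun j _ => ?_
  have := (smooth_partialDList [i, j] hφ).continuous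
  fun_prop

lemma modG_cont2 {n : ℕ} {T : Type*} [TopologicalSpace T] {φ : EV n → ℝ}
    (hφ : ContDiff ℝ (⊤ : ℕ∞) φ) (x : EV n) {g : T → EV n} (hg : Continuous g) :
    Continuous (fun t : T => modG φ x (g t)) := by
  unfold modG
  refine continuous_finsetSum _ fun i _ => continuous_finsetSum _ fun j _ => ?_
  have := (smooth_partialDList [i, j] hφ).continuous
  fun_prop

set_option maxHeartbeats 400000 in
lemma taylor_bound {n : ℕ} {φ : EV n → ℝ} (hφ : ContDiff ℝ (⊤ : ℕ∞) φ) (x h : EV n) :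
    |φ x - φ (x - h) - fderiv ℝ φ x h + 1 / 2 * ∑ i, ∑ j, h i * h j * partialDList [i, j] φ x| ≤
      ‖h‖ ^ 2 * ∫ t in (0:ℝ)..1, modG φ x (t • h) := by
  set S := ∑ i, ∑ j, h i * h j * partialDList [i, j] φ x with hS
  have hline : ∀ t : ℝ, HasDerivAt (fun t : ℝ => x - t • h) (-h) t := by
    intro t
    have := ((hasDerivAt_id t).smul_const h).const_sub x
    simpa using this
  have hd : ∀ (ψ : EV n → ℝ), ContDiff ℝ (⊤ : ℕ∞) ψ → ∀ t : ℝ,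
      HasDerivAt (fun t : ℝ => ψ (x - t • h)) (-(fderiv ℝ ψ (x - t • h) h)) t := by
    intro ψ hψ t
    have := (smooth_diff hψ (x - t • h)).hasFDerivAt.comp_hasDerivAt t (hline t)
    refine HasDerivAt.congr_deriv this ?_
    simp
  let q : ℝ → ℝ := fun t => φ (x - t • h) - φ x + t * fderiv ℝ φ x h - 1 / 2 * t ^ 2 * S
  let q' : ℝ → ℝ := fun t => -(fderiv ℝ φ (x - t • h) h) + fderiv ℝ φ x h - t * S
  let q'' : ℝ → ℝ := fun t =>
    ∑ i, ∑ j, h i * h j * (partialDList [i, j] φ (x - t • h) - partialDList [i, j] φ x)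
  have h1 : ∀ t, HasDerivAt q (q' t) t := by
    intro t
    have e1 := (hd φ hφ t).sub_const (φ x)
    have e2 := (hasDerivAt_id t).mul_const (fderiv ℝ φ x h)
    have e3 := (((hasDerivAt_id t).pow 2).const_mul (1 / 2 : ℝ)).mul_const S
    have := (e1.add e2).sub e3
    refine this.congr_deriv ?_
    simp [q']
  have h2 : ∀ t, HasDerivAt q' (q'' t) t := by
    intro t
    have e1 : HasDerivAt (fun t : ℝ => fderiv ℝ φ (x - t • h) h)
        (∑ j, h j * (-(fderiv ℝ (partialD j φ) (x - t • h) h))) t := by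
      simp only [fderiv_expand φ]
      apply HasDerivAt.fun_sum
      intro j _
      exact (hd _ (smooth_partialD j hφ) t).const_mul (h j)
    have e3 := (hasDerivAt_id t).mul_const S
    have := (e1.neg.add_const (fderiv ℝ φ x h)).sub e3
    refine this.congr_deriv ?_
    simp only [q'', mul_sub, Finset.sum_sub_distrib, ← hS, one_mul]
    congr 1
    simp only [fderiv_expand (partialD _ φ), mul_neg, Finset.sum_neg_distrib, neg_neg,
      Finset.mul_sum]
    rw [Finset.sum_comm]
    refine Finset.sum_congr rfl fun j _ => Finset.sum_congr rfl fun i _ => ?_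
    simp only [partialDList]
    ring
  have hc : Continuous q'' := by
    have hl : Continuous (fun t : ℝ => x - t • h) := by fun_prop
    refine continuous_finsetSum _ fun i _ => continuous_finsetSum _ fun j _ => ?_
    have := (smooth_partialDList [i, j] hφ).continuous
    exact continuous_const.mul ((this.comp hl).sub continuous_const)
  have key := taylor1 h1 h2 hc (by simp [q]) (by simp [q'])
  have hG : Continuous (fun t : ℝ => modG φ x (t • h)) :=
    modG_cont2 hφ x (by fun_prop)
  calc _ = |q 1| := by
        rw [← abs_neg]; congr 1; simp [q]; ring
    _ ≤ ∫ t in (0:ℝ)..1, |q'' t| := key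
    _ ≤ ∫ t in (0:ℝ)..1, ‖h‖ ^ 2 * modG φ x (t • h) := by
        apply intervalIntegral.integral_mono_on zero_le_one (hc.abs.intervalIntegrable _ _)
          ((hG.const_mul _).intervalIntegrable _ _)
        intro t _
        simp only [q'', modG, Finset.mul_sum]
        refine (Finset.abs_sum_le_sum_abs _ _).trans (Finset.sum_le_sum fun i _ => ?_)
        refine (Finset.abs_sum_le_sum_abs _ _).trans (Finset.sum_le_sum fun j _ => ?_)
        rw [abs_mul, abs_mul, sq]
        have hi : |h i| ≤ ‖h‖ := PiLp.norm_apply_le h i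
        have hj : |h j| ≤ ‖h‖ := PiLp.norm_apply_le h j
        gcongr
    _ = _ := by rw [intervalIntegral.integral_const_mul]

lemma rho_integrable {n : ℕ} {ρ : EV n → ℝ} (hρ : A1 ρ) : Integrable ρ volume := by
  obtain ⟨h1, h2, _, _, h5⟩ := hρ
  refine h5.mono h1.aestronglyMeasurable (ae_of_all _ fun x => ?_)
  rw [Real.norm_eq_abs, Real.norm_eq_abs, abs_of_nonneg (h2 x),
    abs_of_nonneg (mul_nonneg (h2 x) (by positivity))]
  nlinarith [h2 x, norm_nonneg x]

lemma nlOp_cov {n : ℕ} (ρ φ : EV n → ℝ) {ε : ℝ} (hε : 0 < ε) (x : EV n) :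
    nlOp ρ ε φ x = ∫ w : EV n, kernelJ ρ w *
      ((ε ^ 2)⁻¹ * (φ x - φ (x - ε • w) - fderiv ℝ φ x (ε • w))) := by
  unfold nlOp
  rw [← integral_sub_left_eq_self (fun z => kernelJ (scaled ρ ε) (x - z) *
    (φ x - φ z - fderiv ℝ φ x (x - z))) volume x]
  have hs : ∀ w : EV n, x - (x - w) = w := fun w => sub_sub_cancel x w
  simp only [hs]
  have := Measure.integral_comp_smul (volume : Measure (EV n))
    (fun z => kernelJ (scaled ρ ε) z * (φ x - φ (x - z) - fderiv ℝ φ x z)) ε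
  rw [finrank_euclideanSpace_fin, abs_of_pos (by positivity), smul_eq_mul] at this
  have h2 : (∫ z, kernelJ (scaled ρ ε) z * (φ x - φ (x - z) - fderiv ℝ φ x z)) = ε ^ n *
      ∫ w, kernelJ (scaled ρ ε) (ε • w) * (φ x - φ (x - ε • w) - fderiv ℝ φ x (ε • w)) := by
    rw [this, ← mul_assoc, mul_inv_cancel₀ (by positivity), one_mul]
  rw [h2, ← integral_const_mul]
  congr 1
  ext w
  simp only [kernelJ, scaled]
  rw [smul_smul, inv_mul_cancel₀ hε.ne', one_smul, norm_smul, Real.norm_of_nonneg hε.le, mul_pow]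
  have : ε ^ n ≠ 0 := by positivity
  by_cases hw : ‖w‖ = 0
  · simp [hw]
  · field_simp

lemma kernel_meas {n : ℕ} {ρ : EV n → ℝ} (hρ : A1 ρ) : Measurable (kernelJ ρ) := by
  unfold kernelJ
  exact hρ.1.div (measurable_norm.pow_const 2)

/-- the averaging measure -/
def nuM {n : ℕ} (ρ : EV n → ℝ) : Measure (EV n × ℝ) :=
  (volume.withDensity fun w => ENNReal.ofReal (ρ w)).prod (volume.restrict (Set.Ioc (0:ℝ) 1))

lemma wd_finite {n : ℕ} {ρ : EV n → ℝ} (hρ : A1 ρ) :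
    IsFiniteMeasure (volume.withDensity fun w => ENNReal.ofReal (ρ w)) :=
  isFiniteMeasure_withDensity_ofReal (rho_integrable hρ).2

lemma nuM_finite {n : ℕ} {ρ : EV n → ℝ} (hρ : A1 ρ) : IsFiniteMeasure (nuM ρ) := by
  have := wd_finite hρ
  unfold nuM
  infer_instance

set_option maxHeartbeats 400000 in
lemma nlOp_bound {n : ℕ} {ρ φ : EV n → ℝ} (hρ : A1 ρ) (hφ : ContDiff ℝ (⊤ : ℕ∞) φ)
    (hφc : HasCompactSupport φ) {ε : ℝ} (hε : 0 < ε) (x : EV n) :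
    ‖nlOp ρ ε φ x + ∑ i : Fin n, ∑ j : Fin n, momentum ρ i j * partialDList [i, j] φ x‖ₑ ≤
      ∫⁻ z, ‖modG φ x ((z.2 * ε) • z.1)‖ₑ ∂(nuM ρ) := by
  have hρi := rho_integrable hρ
  have hkm := kernel_meas hρ
  have hρ0 := hρ.2.1
  have hk0 : ∀ w, 0 ≤ kernelJ ρ w := fun w => div_nonneg (hρ0 w) (by positivity)
  have hkn : ∀ w, kernelJ ρ w * ‖w‖ ^ 2 ≤ ρ w := by
    intro w
    unfold kernelJ
    by_cases hw : ‖w‖ = 0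
    · simp [hw, hρ0 w]
    · field_simp; exact le_refl _
  have hMi : ∀ i j : Fin n, Integrable (fun w : EV n => kernelJ ρ w * w i * w j) volume := by
    intro i j
    refine hρi.mono ?_ (ae_of_all _ fun w => ?_)
    · apply Measurable.aestronglyMeasurable
      have m1 : Measurable fun w : EV n => w i := by fun_prop
      have m2 : Measurable fun w : EV n => w j := by fun_prop
      exact (hkm.mul m1).mul m2
    · have hi : |w i| ≤ ‖w‖ := PiLp.norm_apply_le w i
      have hj : |w j| ≤ ‖w‖ := PiLp.norm_apply_le w j
      rw [Real.norm_eq_abs, Real.norm_of_nonneg (hρ0 w), abs_mul, abs_mul, abs_of_nonneg (hk0 w)]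
      calc _ ≤ kernelJ ρ w * ‖w‖ * ‖w‖ := by
            have := hk0 w
            gcongr
        _ = kernelJ ρ w * ‖w‖ ^ 2 := by ring
        _ ≤ ρ w := hkn w
  let A : EV n → ℝ := fun w => (ε ^ 2)⁻¹ * (φ x - φ (x - ε • w) - fderiv ℝ φ x (ε • w))
  let B : EV n → ℝ := fun w => 1 / 2 * ∑ i, ∑ j, w i * w j * partialDList [i, j] φ x
  let I : EV n → ℝ := fun w => ∫ t in (0:ℝ)..1, modG φ x (t • (ε • w))
  have hI0 : ∀ w, 0 ≤ I w := fun w =>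
    intervalIntegral.integral_nonneg zero_le_one fun t _ => modG_nonneg _ _ _
  have hR : ∀ w, |A w + B w| ≤ ‖w‖ ^ 2 * I w := by
    intro w
    have h := taylor_bound hφ x (ε • w)
    have e1 : A w + B w = (ε ^ 2)⁻¹ * (φ x - φ (x - ε • w) - fderiv ℝ φ x (ε • w) +
        1 / 2 * ∑ i, ∑ j, (ε • w) i * (ε • w) j * partialDList [i, j] φ x) := by
      have : ∑ i, ∑ j, (ε • w) i * (ε • w) j * partialDList [i, j] φ x =
          ε ^ 2 * ∑ i, ∑ j, w i * w j * partialDList [i, j] φ x := by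
        simp only [Finset.mul_sum, PiLp.smul_apply, smul_eq_mul]
        refine Finset.sum_congr rfl fun j _ => Finset.sum_congr rfl fun i _ => ?_
        ring
      rw [this]
      simp only [A, B]
      field_simp
    rw [e1, abs_mul, abs_of_pos (by positivity)]
    calc _ ≤ (ε ^ 2)⁻¹ * (‖ε • w‖ ^ 2 * I w) := by gcongr
      _ = _ := by
        rw [norm_smul, Real.norm_of_nonneg hε.le]
        field_simp
  have hkR : ∀ w, |kernelJ ρ w * (A w + B w)| ≤ ρ w * I w := by
    intro w
    rw [abs_mul, abs_of_nonneg (hk0 w)]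
    calc _ ≤ kernelJ ρ w * (‖w‖ ^ 2 * I w) := mul_le_mul_of_nonneg_left (hR w) (hk0 w)
      _ = kernelJ ρ w * ‖w‖ ^ 2 * I w := by ring
      _ ≤ _ := mul_le_mul_of_nonneg_right (hkn w) (hI0 w)
  obtain ⟨C, hC0, hC⟩ := bound_partialDList hφ hφc
  have hGC : ∀ k, modG φ x k ≤ ∑ i : Fin n, ∑ j : Fin n, (C + C) := by
    intro k
    refine Finset.sum_le_sum fun i _ => Finset.sum_le_sum fun j _ => ?_
    exact (abs_sub _ _).trans (add_le_add (hC _ (by simp) _) (hC _ (by simp) _))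
  have hGc : ∀ w : EV n, Continuous (fun t : ℝ => modG φ x (t • (ε • w))) := fun w =>
    modG_cont2 hφ x (by fun_prop)
  have hIC : ∀ w, I w ≤ ∑ i : Fin n, ∑ j : Fin n, (C + C) := by
    intro w
    have := intervalIntegral.integral_mono_on (μ := volume) zero_le_one
      ((hGc w).intervalIntegrable _ _)
      (intervalIntegrable_const (c := ∑ i : Fin n, ∑ j : Fin n, (C + C))) (fun t _ => hGC _)
    simpa using this
  have hBc : Continuous B := by
    have hci : ∀ i : Fin n, Continuous fun w : EV n => w i := fun i => by fun_prop
    refine continuous_const.mul ?_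
    refine continuous_finsetSum _ fun i _ => continuous_finsetSum _ fun j _ => ?_
    exact ((hci i).mul (hci j)).mul continuous_const
  have hAc : Continuous A := by
    have h1 : Continuous fun w : EV n => ε • w := continuous_const_smul ε
    exact continuous_const.mul ((continuous_const.sub (hφ.continuous.comp
      (continuous_const.sub h1))).sub ((fderiv ℝ φ x).continuous.comp h1))
  have h_intg : Integrable (fun w => kernelJ ρ w * (A w + B w)) volume := by
    refine (hρi.mul_const (∑ i : Fin n, ∑ j : Fin n, (C + C))).mono
      (hkm.mul (hAc.add hBc).measurable).aestronglyMeasurable (ae_of_all _ fun w => ?_)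
    refine (hkR w).trans (le_trans ?_ (le_abs_self _))
    exact mul_le_mul_of_nonneg_left (hIC w) (hρ0 w)
  have hBe : ∀ w, kernelJ ρ w * B w =
      ∑ i, ∑ j, 1 / 2 * partialDList [i, j] φ x * (kernelJ ρ w * w i * w j) := by
    intro w
    simp only [B, Finset.mul_sum]
    refine Finset.sum_congr rfl fun j _ => Finset.sum_congr rfl fun i _ => ?_
    ring
  have hBi : Integrable (fun w => kernelJ ρ w * B w) volume := by
    simp only [hBe]
    exact integrable_finsetSum _ fun i _ => integrable_finsetSum _ fun j _ =>
      (hMi i j).const_mul _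
  have hAi : Integrable (fun w => kernelJ ρ w * A w) volume := by
    refine (h_intg.sub hBi).congr (ae_of_all _ fun w => ?_)
    simp only [Pi.sub_apply]; ring
  have hBv : ∫ w, kernelJ ρ w * B w =
      ∑ i : Fin n, ∑ j : Fin n, momentum ρ i j * partialDList [i, j] φ x := by
    simp only [hBe]
    rw [integral_finsetSum _ fun i _ => integrable_finsetSum _ fun j _ => (hMi i j).const_mul _]
    refine Finset.sum_congr rfl fun i _ => ?_
    rw [integral_finsetSum _ fun j _ => (hMi i j).const_mul _]
    refine Finset.sum_congr rfl fun j _ => ?_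
    rw [integral_const_mul]
    simp only [momentum, Matrix.of_apply]
    ring
  have hE : nlOp ρ ε φ x + ∑ i : Fin n, ∑ j : Fin n, momentum ρ i j * partialDList [i, j] φ x =
      ∫ w, kernelJ ρ w * (A w + B w) := by
    rw [nlOp_cov ρ φ hε x, ← hBv, ← integral_add hAi hBi]
    congr 1
    ext w
    ring
  rw [hE]
  refine (enorm_integral_le_lintegral_enorm _).trans ?_
  have hmG : Measurable (fun z : EV n × ℝ => ‖modG φ x ((z.2 * ε) • z.1)‖ₑ) := by
    apply Measurable.enorm
    apply Continuous.measurable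
    exact modG_cont2 hφ x (by fun_prop)
  have hm : Measurable (fun z => ENNReal.ofReal (ρ z)) := hρ.1.ennreal_ofReal
  have := wd_finite hρ
  unfold nuM
  rw [lintegral_prod _ hmG.aemeasurable,
    lintegral_withDensity_eq_lintegral_mul_non_measurable _ hm (by simp)]
  apply lintegral_mono
  intro w
  simp only [Pi.mul_apply]
  have e1 : ∫⁻ t in Set.Ioc (0:ℝ) 1, ‖modG φ x ((t * ε) • w)‖ₑ = ENNReal.ofReal (I w) := by
    simp only [I]
    rw [intervalIntegral.integral_of_le zero_le_one, ofReal_integral_eq_lintegral_ofReal]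
    · refine lintegral_congr fun t => ?_
      rw [Real.enorm_of_nonneg (modG_nonneg _ _ _), smul_smul]
    · exact ((hGc w).intervalIntegrable 0 1).1
    · exact ae_of_all _ fun t => modG_nonneg _ _ _
  rw [e1, ← ENNReal.ofReal_mul (hρ0 w), Real.enorm_eq_ofReal_abs]
  exact ENNReal.ofReal_le_ofReal (hkR w)

/-- modulus of continuity of the second weak derivatives -/
def Bd {n : ℕ} (D : List (Fin n) → EV n → ℝ) (p : ℝ≥0∞) (k : EV n) : ℝ≥0∞ :=
  ∑ i : Fin n, ∑ j : Fin n, eLpNorm (fun x => D [i, j] (x - k) - D [i, j] x) p volume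

lemma Bd_cont {n : ℕ} {p : ℝ≥0∞} (hp1 : 1 ≤ p) (hp : p ≠ ⊤) {D : List (Fin n) → EV n → ℝ}
    (hm : ∀ l : List (Fin n), l.length ≤ 2 → MemLp (D l) p volume) : Continuous (Bd D p) := by
  unfold Bd
  exact continuous_finsetSum _ fun i _ => continuous_finsetSum _ fun j _ =>
    transl_cont hp1 hp (hm [i, j] (by simp))

lemma Bd_le {n : ℕ} {p : ℝ≥0∞} (hp1 : 1 ≤ p) {D : List (Fin n) → EV n → ℝ}
    (hm : ∀ l : List (Fin n), l.length ≤ 2 → MemLp (D l) p volume) (k : EV n) :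
    Bd D p k ≤ ∑ i : Fin n, ∑ j : Fin n,
      (eLpNorm (D [i, j]) p volume + eLpNorm (D [i, j]) p volume) := by
  refine Finset.sum_le_sum fun i _ => Finset.sum_le_sum fun j _ => ?_
  have h := (hm [i, j] (by simp)).1
  have := eLpNorm_sub_le (aesm_transl h k) h hp1
  rw [eLpNorm_transl h] at this
  exact this

lemma transl_pert {n : ℕ} {p : ℝ≥0∞} (hp1 : 1 ≤ p) {f g : EV n → ℝ}
    (hf : AEStronglyMeasurable f volume) (hg : AEStronglyMeasurable g volume) {a : ℝ≥0∞}
    (ha : eLpNorm (fun x => f x - g x) p volume ≤ a) (k : EV n) :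
    eLpNorm (fun x => |g (x - k) - g x|) p volume ≤
      eLpNorm (fun x => f (x - k) - f x) p volume + (a + a) := by
  obtain ⟨r, hrdef⟩ : ∃ r : EV n → ℝ, r = fun x => f x - g x := ⟨_, rfl⟩
  obtain ⟨s, hsdef⟩ : ∃ s : EV n → ℝ, s = fun x => r (x - k) := ⟨_, rfl⟩
  obtain ⟨d, hddef⟩ : ∃ d : EV n → ℝ, d = fun x => f (x - k) - f x := ⟨_, rfl⟩
  have hr : AEStronglyMeasurable r volume := by rw [hrdef]; exact hf.sub hg
  have hs : AEStronglyMeasurable s volume := by rw [hsdef]; exact aesm_transl hr k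
  have hd : AEStronglyMeasurable d volume := by rw [hddef]; exact (aesm_transl hf k).sub hf
  have e : eLpNorm s p volume = eLpNorm r p volume := by rw [hsdef]; exact eLpNorm_transl hr k
  rw [← hrdef] at ha
  rw [← hddef]
  have e2 : eLpNorm (fun x => |g (x - k) - g x|) p volume = eLpNorm (d + (r - s)) p volume := by
    refine eLpNorm_congr_norm_ae (Eventually.of_forall fun x => ?_)
    have : (d + (r - s)) x = g (x - k) - g x := by
      simp only [Pi.add_apply, Pi.sub_apply, hddef, hrdef, hsdef]; ring
    rw [this, Real.norm_eq_abs, Real.norm_eq_abs, abs_abs]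
  rw [e2]
  have h1 := eLpNorm_add_le hd (hr.sub hs) hp1
  have h2 := eLpNorm_sub_le hr hs hp1
  rw [e] at h2
  exact h1.trans (add_le_add le_rfl (h2.trans (add_le_add ha ha)))

lemma modG_eLpNorm {n : ℕ} {p : ℝ≥0∞} (hp1 : 1 ≤ p) {D : List (Fin n) → EV n → ℝ}
    (hm : ∀ l : List (Fin n), l.length ≤ 2 → MemLp (D l) p volume)
    {φ : EV n → ℝ} (hφ : ContDiff ℝ (⊤ : ℕ∞) φ) {a : ℝ≥0∞}
    (ha : ∀ l : List (Fin n), l.length ≤ 2 →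
      eLpNorm (fun x => D l x - partialDList l φ x) p volume ≤ a) (k : EV n) :
    eLpNorm (fun x => modG φ x k) p volume ≤ Bd D p k + ∑ i : Fin n, ∑ j : Fin n, (a + a) := by
  have hs : ∀ l : List (Fin n), AEStronglyMeasurable (partialDList l φ) volume := fun l =>
    (smooth_partialDList l hφ).continuous.aestronglyMeasurable
  have hd : ∀ l : List (Fin n),
      AEStronglyMeasurable (fun x => partialDList l φ (x - k) - partialDList l φ x) volume :=
    fun l => (aesm_transl (hs l) k).sub (hs l)
  have e : (fun x => modG φ x k) =
      ∑ i, ∑ j, fun x => |partialDList [i, j] φ (x - k) - partialDList [i, j] φ x| := by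
    ext x; simp [modG]
  rw [e, Bd]
  simp only [← Finset.sum_add_distrib]
  refine (eLpNorm_sum_le (fun i _ => ?_) hp1).trans (Finset.sum_le_sum fun i _ => ?_)
  · exact Finset.aestronglyMeasurable_sum _ fun j _ => (hd _).norm
  refine (eLpNorm_sum_le (fun j _ => (hd _).norm) hp1).trans (Finset.sum_le_sum fun j _ => ?_)
  have hl : [i, j].length ≤ 2 := by simp
  exact transl_pert hp1 (hm [i, j] hl).1 (hs [i, j]) (ha [i, j] hl) k

lemma smooth_est {n : ℕ} {ρ : EV n → ℝ} (hρ : A1 ρ) {p : ℝ≥0∞} (hp1 : 1 ≤ p) (hp : p ≠ ⊤)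
    {D : List (Fin n) → EV n → ℝ}
    (hm : ∀ l : List (Fin n), l.length ≤ 2 → MemLp (D l) p volume)
    {φ : EV n → ℝ} (hφ : ContDiff ℝ (⊤ : ℕ∞) φ) (hφc : HasCompactSupport φ) {a : ℝ≥0∞}
    (ha : ∀ l : List (Fin n), l.length ≤ 2 →
      eLpNorm (fun x => D l x - partialDList l φ x) p volume ≤ a) {ε : ℝ} (hε : 0 < ε) :
    eLpNorm (fun x => nlOp ρ ε φ x +
        ∑ i : Fin n, ∑ j : Fin n, momentum ρ i j * partialDList [i, j] φ x) p volume ≤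
      (nuM ρ Set.univ ^ (p.toReal - 1) * ∫⁻ z, (Bd D p ((z.2 * ε) • z.1) +
        ∑ i : Fin n, ∑ j : Fin n, (a + a)) ^ p.toReal ∂(nuM ρ)) ^ (1 / p.toReal) := by
  have hq0 : 0 < p.toReal := ENNReal.toReal_pos (zero_lt_one.trans_le hp1).ne' hp
  have := nuM_finite hρ
  have key := jensen_tonelli (μ := volume) (ν := nuM ρ) hp1 hp (fun x => nlOp ρ ε φ x +
        ∑ i : Fin n, ∑ j : Fin n, momentum ρ i j * partialDList [i, j] φ x)
        (fun x z => modG φ x ((z.2 * ε) • z.1)) ?_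
        (ae_of_all _ fun x => nlOp_bound hρ hφ hφc hε x)
  · rw [one_div, ENNReal.le_rpow_inv_iff hq0]
    refine key.trans ?_
    gcongr with z
    exact modG_eLpNorm hp1 hm hφ ha _
  · apply Continuous.aestronglyMeasurable
    unfold Function.uncurry modG
    refine continuous_finsetSum _ fun i _ => continuous_finsetSum _ fun j _ => ?_
    have := (smooth_partialDList [i, j] hφ).continuous
    fun_prop

lemma rhs_tendsto {n : ℕ} {ρ : EV n → ℝ} (hρ : A1 ρ) {p : ℝ≥0∞} (hp1 : 1 ≤ p) (hp : p ≠ ⊤)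
    {D : List (Fin n) → EV n → ℝ}
    (hm : ∀ l : List (Fin n), l.length ≤ 2 → MemLp (D l) p volume) :
    Tendsto (fun ε : ℝ => (nuM ρ Set.univ ^ (p.toReal - 1) * ∫⁻ z, (Bd D p ((z.2 * ε) • z.1) +
        ∑ i : Fin n, ∑ j : Fin n, (ENNReal.ofReal ε + ENNReal.ofReal ε)) ^ p.toReal
          ∂(nuM ρ)) ^ (1 / p.toReal)) (𝓝[>] 0) (𝓝 0) := by
  have hq : 1 ≤ p.toReal := by
    rw [← ENNReal.toReal_one]; exact ENNReal.toReal_mono hp hp1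
  have hq0 : 0 < p.toReal := by linarith
  have := nuM_finite hρ
  have hBc := Bd_cont hp1 hp hm
  have h1 : Tendsto (fun ε : ℝ => ∫⁻ z, (Bd D p ((z.2 * ε) • z.1) +
        ∑ i : Fin n, ∑ j : Fin n, (ENNReal.ofReal ε + ENNReal.ofReal ε)) ^ p.toReal
          ∂(nuM ρ)) (𝓝[>] 0) (𝓝 (∫⁻ z, 0 ∂(nuM ρ))) := by
    apply tendsto_lintegral_filter_of_dominated_convergence
      (fun _ => ((∑ i : Fin n, ∑ j : Fin n,
        (eLpNorm (D [i, j]) p volume + eLpNorm (D [i, j]) p volume)) +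
        ∑ i : Fin n, ∑ j : Fin n, (1 + 1)) ^ p.toReal)
    · refine Eventually.of_forall fun ε => ?_
      apply Measurable.pow_const
      apply Measurable.add_const
      have h : Continuous (fun z : EV n × ℝ => (z.2 * ε) • z.1) := by fun_prop
      exact hBc.measurable.comp h.measurable
    · have : ∀ᶠ ε in 𝓝[>] (0:ℝ), ε < 1 := nhdsWithin_le_nhds (eventually_lt_nhds zero_lt_one)
      filter_upwards [this] with ε hε
      refine ae_of_all _ fun z => ?_
      have h1 : ENNReal.ofReal ε ≤ 1 := by
        rw [← ENNReal.ofReal_one]; exact ENNReal.ofReal_le_ofReal hε.le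
      have h2 := Bd_le hp1 hm ((z.2 * ε) • z.1)
      gcongr
    · rw [lintegral_const]
      refine ENNReal.mul_ne_top (ENNReal.rpow_ne_top_of_nonneg hq0.le ?_) (measure_ne_top _ _)
      refine ENNReal.add_ne_top.2 ⟨?_, ?_⟩
      · refine ENNReal.sum_ne_top.2 fun i _ => ENNReal.sum_ne_top.2 fun j _ => ?_
        have := (hm [i, j] (by simp)).2.ne
        exact ENNReal.add_ne_top.2 ⟨this, this⟩
      · refine ENNReal.sum_ne_top.2 fun i _ => ENNReal.sum_ne_top.2 fun j _ => ?_
        simp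
    · refine ae_of_all _ fun z => ?_
      have hc : Continuous (fun ε : ℝ => (Bd D p ((z.2 * ε) • z.1) +
        ∑ i : Fin n, ∑ j : Fin n, (ENNReal.ofReal ε + ENNReal.ofReal ε)) ^ p.toReal) := by
        apply ENNReal.continuous_rpow_const.comp
        apply Continuous.add
        · have h : Continuous (fun ε : ℝ => (z.2 * ε) • z.1) := by fun_prop
          exact hBc.comp h
        · exact continuous_finsetSum _ fun i _ => continuous_finsetSum _ fun j _ =>
            ENNReal.continuous_ofReal.add ENNReal.continuous_ofReal
      have := (hc.tendsto 0).mono_left (nhdsWithin_le_nhds (s := Set.Ioi 0))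
      simpa [Bd, ENNReal.zero_rpow_of_pos hq0] using this
  rw [lintegral_zero] at h1
  have hK : nuM ρ Set.univ ^ (p.toReal - 1) ≠ ⊤ :=
    ENNReal.rpow_ne_top_of_nonneg (by linarith) (measure_ne_top _ _)
  have h2 := ENNReal.Tendsto.const_mul h1 (Or.inr hK)
  have h3 := (ENNReal.continuous_rpow_const (y := 1 / p.toReal)).tendsto _ |>.comp h2
  rw [mul_zero, ENNReal.zero_rpow_of_pos (by positivity)] at h3
  exact h3

/-- nonlocal-to-local convergence on `ℝⁿ`: for every `u ∈ W^{2,p}(ℝⁿ)`,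
`L_ε u → L u = -div(M ∇u)` strongly in `L^p(ℝⁿ)` as `ε → 0`, where `L_ε` denotes (any
choice of) the bounded linear extension of the nonlocal operator to `W^{2,p}(ℝⁿ)`.
Here `-div(M ∇u) = -∑_{i,j} M_{ij} ∂ᵢ∂ⱼ u` is expressed via the weak derivatives `D`. -/
theorem nlOp_to_local_convergence_Rn (n : ℕ) (hn : 1 ≤ n) (ρ : EV n → ℝ) (hρ : A1 ρ)
    (p : ℝ≥0∞) (hp1 : 1 ≤ p) (hp : p ≠ ⊤)
    (L : ℝ → (EV n → ℝ) → EV n → ℝ)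
    (hL : ∀ ε : ℝ, 0 < ε → ∃ C : ℝ, 0 < C ∧ IsNLExt ρ p ε C (L ε))
    (u : EV n → ℝ) (D : List (Fin n) → EV n → ℝ)
    (hD : IsSobDerivs Set.univ 2 p u D) :
    Tendsto
      (fun ε : ℝ =>
        eLpNorm
          (fun x => L ε u x + ∑ i : Fin n, ∑ j : Fin n, momentum ρ i j * D [i, j] x)
          p volume)
      (𝓝[>] 0) (𝓝 0) := by
  have hm : ∀ l : List (Fin n), l.length ≤ 2 → MemLp (D l) p volume := by
    simpa using hD.2.2
  have hofε : Tendsto (fun ε : ℝ => ENNReal.ofReal ε) (𝓝[>] 0) (𝓝 0) := by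
    have := (ENNReal.continuous_ofReal.tendsto 0).mono_left (nhdsWithin_le_nhds (s := Set.Ioi 0))
    simpa using this
  have hlim : Tendsto (fun ε : ℝ => ENNReal.ofReal ε +
      ((nuM ρ Set.univ ^ (p.toReal - 1) * ∫⁻ z, (Bd D p ((z.2 * ε) • z.1) +
        ∑ i : Fin n, ∑ j : Fin n, (ENNReal.ofReal ε + ENNReal.ofReal ε)) ^ p.toReal
          ∂(nuM ρ)) ^ (1 / p.toReal) +
      (∑ i : Fin n, ∑ j : Fin n, ‖momentum ρ i j‖ₑ) * ENNReal.ofReal ε)) (𝓝[>] 0) (𝓝 0) := by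
    have hK : (∑ i : Fin n, ∑ j : Fin n, ‖momentum ρ i j‖ₑ) ≠ ⊤ :=
      ENNReal.sum_ne_top.2 fun i _ => ENNReal.sum_ne_top.2 fun j _ => enorm_ne_top
    have := hofε.add ((rhs_tendsto hρ hp1 hp hm).add (ENNReal.Tendsto.const_mul hofε (Or.inr hK)))
    simpa using this
  refine tendsto_of_tendsto_of_tendsto_of_le_of_le' tendsto_const_nhds hlim
    (Eventually.of_forall fun _ => zero_le) ?_
  filter_upwards [self_mem_nhdsWithin] with ε hε
  have hε : 0 < ε := hε
  obtain ⟨C, hC, hL1, hL2, hL3, hL4⟩ := hL ε hε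
  set N : ℝ := ((shortLists n).card : ℝ) with hN
  have hN0 : 0 ≤ N := Nat.cast_nonneg _
  have hden : 0 < 1 + C * N := by positivity
  have ha0 : 0 < ENNReal.ofReal (ε / (1 + C * N)) := ENNReal.ofReal_pos.2 (by positivity)
  have ha1 : ENNReal.ofReal (ε / (1 + C * N)) ≤ ENNReal.ofReal ε := by
    apply ENNReal.ofReal_le_ofReal
    apply div_le_self hε.le
    have : 0 ≤ C * N := by positivity
    linarith
  obtain ⟨φ, hφ, hφc, hclose⟩ := exists_approx hp1 hp hD ha0
  have hclose' : ∀ l : List (Fin n), l.length ≤ 2 →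
      eLpNorm (fun x => D l x - partialDList l φ x) p volume ≤ ENNReal.ofReal ε :=
    fun l hl => (hclose l hl).trans ha1
  have sφ : IsSobDerivs Set.univ 2 p φ (fun l => partialDList l φ) := sob_smooth hφ hφc
  have sd := sob_sub hp1 hD sφ
  have hW := WNormD_le hclose
  have hlin := hL2 u φ ⟨D, hD⟩ ⟨_, sφ⟩ 1 (-1)
  have hnl := hL1 φ (contDiff_infty.1 hφ 2) hφc
  have b1 : eLpNorm (L ε (fun x => 1 * u x + (-1) * φ x)) p volume ≤ ENNReal.ofReal ε := by
    refine (hL4 _ _ sd).trans ((mul_le_mul_right hW _).trans ?_)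
    rw [← ENNReal.ofReal_natCast, ← ENNReal.ofReal_mul hN0, ← ENNReal.ofReal_mul hC.le]
    apply ENNReal.ofReal_le_ofReal
    rw [← mul_assoc, mul_div_assoc', div_le_iff₀ hden]
    nlinarith
  have hs : ∀ l : List (Fin n), AEStronglyMeasurable (partialDList l φ) volume := fun l =>
    (smooth_partialDList l hφ).continuous.aestronglyMeasurable
  have b2 := smooth_est hρ hp1 hp hm hφ hφc hclose' hε
  have hr : ∀ i j : Fin n, AEStronglyMeasurable
      (fun x => momentum ρ i j * (D [i, j] x - partialDList [i, j] φ x)) volume := fun i j =>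
    ((hm [i, j] (by simp)).1.sub (hs _)).const_mul _
  have b3 : eLpNorm (∑ i : Fin n, ∑ j : Fin n, fun x => momentum ρ i j *
      (D [i, j] x - partialDList [i, j] φ x)) p volume ≤
      (∑ i : Fin n, ∑ j : Fin n, ‖momentum ρ i j‖ₑ) * ENNReal.ofReal ε := by
    simp only [Finset.sum_mul]
    refine (eLpNorm_sum_le (fun i _ => ?_) hp1).trans (Finset.sum_le_sum fun i _ => ?_)
    · exact Finset.aestronglyMeasurable_sum _ fun j _ => hr i j
    refine (eLpNorm_sum_le (fun j _ => hr i j) hp1).trans (Finset.sum_le_sum fun j _ => ?_)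
    have := eLpNorm_const_smul_le (c := momentum ρ i j)
      (f := fun x => D [i, j] x - partialDList [i, j] φ x) (p := p) (μ := volume)
    refine le_trans this ?_
    exact mul_le_mul_right (hclose' [i, j] (by simp)) _
  have hEm : AEStronglyMeasurable (fun x => nlOp ρ ε φ x +
        ∑ i : Fin n, ∑ j : Fin n, momentum ρ i j * partialDList [i, j] φ x) volume := by
    apply AEStronglyMeasurable.add
    · exact (hL3 φ ⟨_, sφ⟩).1.congr hnl
    · apply Continuous.aestronglyMeasurable
      refine continuous_finsetSum _ fun i _ => continuous_finsetSum _ fun j _ => ?_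
      exact continuous_const.mul (smooth_partialDList [i, j] hφ).continuous
  have heq : (fun x => L ε u x + ∑ i : Fin n, ∑ j : Fin n, momentum ρ i j * D [i, j] x) =ᵐ[volume]
      L ε (fun x => 1 * u x + (-1) * φ x) + ((fun x => nlOp ρ ε φ x +
        ∑ i : Fin n, ∑ j : Fin n, momentum ρ i j * partialDList [i, j] φ x) +
        ∑ i : Fin n, ∑ j : Fin n, fun x => momentum ρ i j *
          (D [i, j] x - partialDList [i, j] φ x)) := by
    filter_upwards [hlin, hnl] with x h1 h2
    simp only [Pi.add_apply, Finset.sum_apply, h1, h2, mul_sub, Finset.sum_sub_distrib]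
    ring
  rw [eLpNorm_congr_ae heq]
  have hRm : AEStronglyMeasurable (∑ i : Fin n, ∑ j : Fin n, fun x => momentum ρ i j *
      (D [i, j] x - partialDList [i, j] φ x)) volume :=
    Finset.aestronglyMeasurable_sum _ fun i _ => Finset.aestronglyMeasurable_sum _ fun j _ => hr i j
  refine (eLpNorm_add_le (hL3 _ ⟨_, sd⟩).1 (hEm.add hRm) hp1).trans ?_
  refine add_le_add b1 ((eLpNorm_add_le hEm hRm hp1).trans (add_le_add b2 b3))
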